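/- arXiv:1707.02395 — 2 statements merged into one kernel-verified Lean document; each statement's English description precedes it below -/
import Mathlib

section
/- Let σ > 0 and u, ω ∈ ℝ. Then Φ^σ(ω, u) = N^{1/σ}(ω) · [ Φ₀^σ(u) + i σ² ω N^σ(u) · ∫_{0}^{1} exp(−i u ω x) exp(σ² ω² x² / 2) dx ]. -/
open MeasureTheory Complex

/-- The Gaussian `N^β(x) = exp(-x²/(2β²))`. -/
noncomputable def gaussN (β x : ℝ) : ℝ := Real.exp (-(x ^ 2) / (2 * β ^ 2))

lemma gaussN_eq (σ x : ℝ) : gaussN σ x = Real.exp (-(1 / (2 * σ ^ 2)) * x ^ 2) := by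
  rw [gaussN]; congr 1; ring

lemma integrable_gaussN {σ : ℝ} (hσ : 0 < σ) : Integrable (gaussN σ) := by
  simpa only [← gaussN_eq] using
    integrable_exp_neg_mul_sq (show (0 : ℝ) < 1 / (2 * σ ^ 2) by positivity)

lemma integrable_id_mul_gaussN {σ : ℝ} (hσ : 0 < σ) : Integrable fun x ↦ x * gaussN σ x := by
  simpa only [← gaussN_eq] using
    integrable_mul_exp_neg_mul_sq (show (0 : ℝ) < 1 / (2 * σ ^ 2) by positivity)

lemma continuous_gaussN (σ : ℝ) : Continuous (gaussN σ) := by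
  unfold gaussN; fun_prop

lemma hasDerivAt_gaussN {σ : ℝ} (hσ : 0 < σ) (x : ℝ) :
    HasDerivAt (gaussN σ) (-(x * gaussN σ x) / σ ^ 2) x := by
  have h := ((((hasDerivAt_id x).pow 2).neg).div_const (2 * σ ^ 2)).exp
  refine h.congr_deriv ?_
  simp only [gaussN, id, Pi.neg_apply, Pi.pow_apply]
  field_simp
  push_cast
  ring

lemma norm_exp_neg_I_mul_ofReal (t : ℝ) : ‖exp (-I * (t : ℂ))‖ = 1 := by
  have h : -I * (t : ℂ) = ((-t : ℝ) : ℂ) * I := by push_cast; ring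
  rw [h, norm_exp_ofReal_mul_I]

lemma integrable_exp_mul_ofReal {g : ℝ → ℝ} (hg : Integrable g) (ω : ℝ) :
    Integrable fun x : ℝ ↦ exp (-I * ((ω * x : ℝ) : ℂ)) * (g x : ℂ) :=
  hg.ofReal.bdd_mul (c := 1)
    (Continuous.aestronglyMeasurable (by fun_prop))
    (Filter.Eventually.of_forall fun x ↦ (norm_exp_neg_I_mul_ofReal _).le)

/-- The Fourier integral of the Gaussian truncated to `(-∞, u]`. -/
noncomputable def truncFourier (σ u ω : ℝ) : ℂ :=
  ∫ x in Set.Iic u, exp (-I * ((ω * x : ℝ) : ℂ)) * ((gaussN σ x : ℝ) : ℂ)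

lemma hasDerivAt_exp_neg_I_mul (ω x : ℝ) :
    HasDerivAt (fun x : ℝ ↦ exp (-I * ((ω * x : ℝ) : ℂ)))
      (-I * ω * exp (-I * ((ω * x : ℝ) : ℂ))) x := by
  have h := ((((hasDerivAt_id x).const_mul ω).ofReal_comp).const_mul (-I)).cexp
  refine h.congr_deriv ?_
  simp only [id, mul_one]
  ring

lemma hasDerivAt_truncFourier_integral {σ : ℝ} (hσ : 0 < σ) (u ω : ℝ) :
    HasDerivAt (truncFourier σ u)
      (∫ x in Set.Iic u, -I * (exp (-I * ((ω * x : ℝ) : ℂ)) * ((x * gaussN σ x : ℝ) : ℂ))) ω := by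
  have hc := continuous_gaussN σ
  refine (hasDerivAt_integral_of_dominated_loc_of_deriv_le (μ := volume.restrict (Set.Iic u))
    (bound := fun x ↦ ‖x * gaussN σ x‖)
    (F' := fun (ω x : ℝ) ↦ -I * (exp (-I * ((ω * x : ℝ) : ℂ)) * ((x * gaussN σ x : ℝ) : ℂ)))
    Filter.univ_mem
    (Filter.Eventually.of_forall fun t ↦
      (integrable_exp_mul_ofReal (integrable_gaussN hσ) t).integrableOn.aestronglyMeasurable)
    (integrable_exp_mul_ofReal (integrable_gaussN hσ) ω).integrableOn
    (Continuous.aestronglyMeasurable (by fun_prop)) ?_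
    (integrable_id_mul_gaussN hσ).norm.integrableOn ?_).2
  · refine Filter.Eventually.of_forall fun x t _ ↦ ?_
    rw [norm_mul, norm_mul, norm_exp_neg_I_mul_ofReal, norm_real, norm_neg, norm_I, one_mul,
      one_mul]
  · refine Filter.Eventually.of_forall fun x t _ ↦ ?_
    have h := (hasDerivAt_exp_neg_I_mul x t).mul_const ((gaussN σ x : ℝ) : ℂ)
    simp only [mul_comm x] at h
    refine h.congr_deriv ?_
    push_cast
    ring

/-- Integration by parts for the first moment of the truncated Gaussian. -/
lemma integral_id_mul_gaussN {σ : ℝ} (hσ : 0 < σ) (u ω : ℝ) :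
    ∫ x in Set.Iic u, -I * (exp (-I * ((ω * x : ℝ) : ℂ)) * ((x * gaussN σ x : ℝ) : ℂ)) =
      I * σ ^ 2 * (exp (-I * ((ω * u : ℝ) : ℂ)) * ((gaussN σ u : ℝ) : ℂ)) -
        σ ^ 2 * ω * truncFourier σ u ω := by
  have h0 := integrable_exp_mul_ofReal (integrable_gaussN hσ) ω
  have h1 := (integrable_exp_mul_ofReal (integrable_id_mul_gaussN hσ) ω).const_mul (-I)
  have hσ' : (σ : ℂ) ≠ 0 := by exact_mod_cast hσ.ne'
  have hd : ∀ x : ℝ, HasDerivAt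
      (fun x : ℝ ↦ I * σ ^ 2 * (exp (-I * ((ω * x : ℝ) : ℂ)) * ((gaussN σ x : ℝ) : ℂ)))
      (-I * (exp (-I * ((ω * x : ℝ) : ℂ)) * ((x * gaussN σ x : ℝ) : ℂ)) +
        σ ^ 2 * ω * (exp (-I * ((ω * x : ℝ) : ℂ)) * ((gaussN σ x : ℝ) : ℂ))) x := by
    intro x
    refine (((hasDerivAt_exp_neg_I_mul ω x).mul
      (hasDerivAt_gaussN hσ x).ofReal_comp).const_mul (I * (σ : ℂ) ^ 2)).congr_deriv ?_
    push_cast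
    field_simp
    linear_combination (-(σ : ℂ) ^ 2 * ω * gaussN σ x) * I_sq
  have hi := h1.add (h0.const_mul ((σ : ℂ) ^ 2 * ω))
  have ht := tendsto_zero_of_hasDerivAt_of_integrableOn_Iic (a := u) (fun x _ ↦ hd x)
    hi.integrableOn (h0.const_mul (I * (σ : ℂ) ^ 2)).integrableOn
  have h := integral_Iic_of_hasDerivAt_of_tendsto' (a := u) (fun x _ ↦ hd x) hi.integrableOn ht
  rw [integral_add h1.integrableOn (h0.const_mul _).integrableOn, integral_const_mul
    ((σ : ℂ) ^ 2 * ω), sub_zero] at h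
  rw [← h, truncFourier]
  ring

lemma hasDerivAt_exp_mul_truncFourier {σ : ℝ} (hσ : 0 < σ) (u ω : ℝ) :
    HasDerivAt (fun t : ℝ ↦ ((Real.exp (σ ^ 2 * t ^ 2 / 2) : ℝ) : ℂ) * truncFourier σ u t)
      (I * σ ^ 2 * gaussN σ u *
        (exp (-I * ((u * ω : ℝ) : ℂ)) * ((Real.exp (σ ^ 2 * ω ^ 2 / 2) : ℝ) : ℂ))) ω := by
  have he : HasDerivAt (fun t : ℝ ↦ Real.exp (σ ^ 2 * t ^ 2 / 2))
      (σ ^ 2 * ω * Real.exp (σ ^ 2 * ω ^ 2 / 2)) ω := by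
    refine (((hasDerivAt_pow 2 ω).const_mul (σ ^ 2)).div_const 2).exp.congr_deriv ?_
    push_cast
    ring
  refine (he.ofReal_comp.mul (hasDerivAt_truncFourier_integral hσ u ω)).congr_deriv ?_
  rw [integral_id_mul_gaussN hσ, mul_comm u ω]
  push_cast
  ring

/-- Exact expansion of the Fourier transform of a truncated Gaussian:
`Φ^σ(ω,u) = N^{1/σ}(ω) [Φ₀^σ(u) + iσ²ω N^σ(u) ∫₀¹ exp(-iuωx) exp(σ²ω²x²/2) dx]`. -/
theorem truncated_gaussian_fourier_expansion (σ u ω : ℝ) (hσ : 0 < σ) :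
    (∫ x in Set.Iic u, Complex.exp (-Complex.I * ((ω * x : ℝ) : ℂ)) * ((gaussN σ x : ℝ) : ℂ)) =
      ((gaussN (1 / σ) ω : ℝ) : ℂ) *
        (((∫ x in Set.Iic u, gaussN σ x : ℝ) : ℂ) +
          Complex.I * ((σ ^ 2 * ω : ℝ) : ℂ) * ((gaussN σ u : ℝ) : ℂ) *
            ∫ x in (0:ℝ)..1,
              Complex.exp (-Complex.I * ((u * ω * x : ℝ) : ℂ)) *
                ((Real.exp (σ ^ 2 * ω ^ 2 * x ^ 2 / 2) : ℝ) : ℂ)) := by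
  have hftc := intervalIntegral.integral_eq_sub_of_hasDerivAt (a := 0) (b := ω)
    (fun t _ ↦ hasDerivAt_exp_mul_truncFourier hσ u t)
    (Continuous.intervalIntegrable (by fun_prop) _ _)
  have hsub := intervalIntegral.smul_integral_comp_mul_left (a := 0) (b := 1)
    (fun t : ℝ ↦ exp (-I * ((u * t : ℝ) : ℂ)) * ((Real.exp (σ ^ 2 * t ^ 2 / 2) : ℝ) : ℂ)) ω
  have h0 : truncFourier σ u 0 = ((∫ x in Set.Iic u, gaussN σ x : ℝ) : ℂ) := by
    rw [truncFourier, ← integral_complex_ofReal]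
    simp
  have hN : (gaussN (1 / σ) ω : ℂ) * ((Real.exp (σ ^ 2 * ω ^ 2 / 2) : ℝ) : ℂ) = 1 := by
    have he : -(ω ^ 2) / (2 * (1 / σ) ^ 2) + σ ^ 2 * ω ^ 2 / 2 = 0 := by
      field_simp
      ring
    rw [gaussN, ← ofReal_mul, ← Real.exp_add, he, Real.exp_zero, ofReal_one]
  rw [intervalIntegral.integral_const_mul] at hftc
  simp only [mul_zero, mul_one, mul_pow, ← mul_assoc, real_smul] at hsub hftc ⊢
  rw [← hsub, h0] at hftc
  simp only [ne_eq, OfNat.ofNat_ne_zero, not_false_eq_true, zero_pow, mul_zero, zero_div,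
    Real.exp_zero, ofReal_one, one_mul] at hftc
  change truncFourier σ u ω = _
  push_cast at hftc hN ⊢
  linear_combination (-truncFourier σ u ω) * hN - (gaussN (1 / σ) ω : ℂ) * hftc
end

section
/- Let β, σ > 0, ω, c ∈ ℝ, and set s = √(β² + σ²). Then ∫_{ℝ} exp(−iωy) · N^β(y) · Φ₀^σ(y + c) dy = √(2π) · (βσ/s) · exp( −ω² β² σ² / (2s²) ) · Φ^s( −ω β²/s², c ). -/
open MeasureTheory Complex

lemma integrable_gaussN_s11 {β : ℝ} (hβ : 0 < β) : Integrable (gaussN β) := by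
  have h := integrable_exp_neg_mul_sq (b := 1 / (2 * β ^ 2)) (by positivity)
  refine h.congr (Filter.Eventually.of_forall fun x => ?_)
  simp only [gaussN]
  congr 1
  ring

lemma integrable_cexp_mul_gaussN {β : ℝ} (hβ : 0 < β) (ω : ℝ) :
    Integrable fun y : ℝ =>
      Complex.exp (-Complex.I * ((ω * y : ℝ) : ℂ)) * ((gaussN β y : ℝ) : ℂ) := by
  refine (integrable_gaussN_s11 hβ).ofReal.bdd_mul (c := 1) (by fun_prop)
    (Filter.Eventually.of_forall fun y => ?_)
  rw [neg_mul, mul_comm, ← neg_mul, ← Complex.ofReal_neg, Complex.norm_exp_ofReal_mul_I]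

lemma setIntegral_Iic_add (f : ℝ → ℝ) (y c : ℝ) :
    ∫ x in Set.Iic (y + c), f x = ∫ x in Set.Iic c, f (y + x) := by
  rw [← (measurePreserving_add_left volume y).setIntegral_preimage_emb
    (measurableEmbedding_addLeft y)]
  simp

/-- The Fourier transform of a product of a centred and a shifted Gaussian. -/
lemma integral_cexp_mul_gaussN_mul_gaussN {β σ s : ℝ} (hβ : 0 < β) (hσ : 0 < σ) (hs : 0 < s)
    (hs2 : s ^ 2 = β ^ 2 + σ ^ 2) (ω x : ℝ) :
    ∫ y : ℝ, Complex.exp (-Complex.I * ((ω * y : ℝ) : ℂ)) * ((gaussN β y : ℝ) : ℂ) *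
        ((gaussN σ (y + x) : ℝ) : ℂ) =
      ((Real.sqrt (2 * Real.pi) * (β * σ / s) : ℝ) : ℂ) *
        ((Real.exp (-(ω ^ 2 * β ^ 2 * σ ^ 2) / (2 * s ^ 2)) : ℝ) : ℂ) *
        (Complex.exp (-Complex.I * ((-(ω * β ^ 2 / s ^ 2) * x : ℝ) : ℂ)) *
            ((gaussN s x : ℝ) : ℂ)) := by
  have hβ' : (β : ℂ) ≠ 0 := by exact_mod_cast hβ.ne'
  have hσ' : (σ : ℂ) ≠ 0 := by exact_mod_cast hσ.ne'
  have hs' : (s : ℂ) ≠ 0 := by exact_mod_cast hs.ne'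
  have hs2' : (s : ℂ) ^ 2 = β ^ 2 + σ ^ 2 := by exact_mod_cast hs2
  have hb : ((-(s ^ 2 / (2 * β ^ 2 * σ ^ 2)) : ℝ) : ℂ).re < 0 := by
    rw [Complex.ofReal_re, neg_lt_zero]
    positivity
  have key := integral_cexp_quadratic hb (-Complex.I * ω - x / σ ^ 2) (-x ^ 2 / (2 * σ ^ 2))
  have hroot : ((Real.pi : ℂ) / -((-(s ^ 2 / (2 * β ^ 2 * σ ^ 2)) : ℝ) : ℂ)) ^ (1 / 2 : ℂ) =
      ((Real.sqrt (2 * Real.pi) * (β * σ / s) : ℝ) : ℂ) := by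
    have hpos : 0 < Real.sqrt (2 * Real.pi) * (β * σ / s) := by positivity
    rw [one_div, ← Complex.sq_cpow_two_inv (x := ((Real.sqrt (2 * Real.pi) * (β * σ / s) : ℝ) : ℂ))
      (by rwa [Complex.ofReal_re])]
    congr 1
    rw [← Complex.ofReal_pow, mul_pow, Real.sq_sqrt (by positivity)]
    push_cast
    field_simp
  rw [hroot] at key
  calc _ = _ := integral_congr_ae (Filter.Eventually.of_forall fun y => ?_)
    _ = _ := key
    _ = _ := ?_
  · simp only [gaussN, Complex.ofReal_exp, ← Complex.exp_add]
    congr 1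
    push_cast
    rw [hs2']
    field_simp
    ring
  · simp only [gaussN, Complex.ofReal_exp, mul_assoc, ← Complex.exp_add]
    congr 3
    push_cast
    field_simp
    ring_nf
    simp only [Complex.I_sq]
    linear_combination -4 * (x : ℂ) ^ 2 * hs2'

/-- Fourier–Gaussian-cumulative identity: the Fourier-weighted integral of a Gaussian
multiplied by a Gaussian cumulative distribution equals a Gaussian factor times a
truncated-Gaussian Fourier integral with combined width `s = √(β² + σ²)`. -/
theorem fourier_gaussian_cumulative
    (β σ : ℝ) (hβ : 0 < β) (hσ : 0 < σ) (ω c s : ℝ)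
    (hs : s = Real.sqrt (β ^ 2 + σ ^ 2)) :
    (∫ y : ℝ, Complex.exp (-Complex.I * ((ω * y : ℝ) : ℂ)) * ((gaussN β y : ℝ) : ℂ) *
        ((∫ x in Set.Iic (y + c), gaussN σ x : ℝ) : ℂ)) =
      ((Real.sqrt (2 * Real.pi) * (β * σ / s) : ℝ) : ℂ) *
        ((Real.exp (-(ω ^ 2 * β ^ 2 * σ ^ 2) / (2 * s ^ 2)) : ℝ) : ℂ) *
        ∫ x in Set.Iic c,
          Complex.exp (-Complex.I * ((-(ω * β ^ 2 / s ^ 2) * x : ℝ) : ℂ)) *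
            ((gaussN s x : ℝ) : ℂ) := by
  have hspos : 0 < s := by rw [hs]; positivity
  have hs2 : s ^ 2 = β ^ 2 + σ ^ 2 := by rw [hs, Real.sq_sqrt (by positivity)]
  have hint : Integrable (Function.uncurry fun y x : ℝ =>
      Complex.exp (-Complex.I * ((ω * y : ℝ) : ℂ)) * ((gaussN β y : ℝ) : ℂ) *
        ((gaussN σ (y + x) : ℝ) : ℂ)) (volume.prod (volume.restrict (Set.Iic c))) := by
    have h := (measurePreserving_prod_add (volume : Measure ℝ) volume).integrable_comp_of_integrable
      ((integrable_cexp_mul_gaussN hβ ω).mul_prod (integrable_gaussN_s11 hσ).ofReal)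
    exact h.mono_measure (Measure.prod_mono le_rfl Measure.restrict_le_self)
  simp_rw [setIntegral_Iic_add, ← integral_complex_ofReal, ← integral_const_mul]
  rw [integral_integral_swap hint]
  simp_rw [integral_cexp_mul_gaussN_mul_gaussN hβ hσ hspos hs2]
end
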